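/- arXiv:2401.06368 — 2 statements merged into one kernel-verified Lean document; each statement's English description precedes it below -/
import Mathlib

section
/- Let N be a positive integer, p a prime dividing N, n = v_p(N) ≥ 1, N_p = N·p^{−n}, and let k be an integer with 0 ≤ k < n. Set C_{N_p} := Π_{t ∣ N_p} t^{−12·a_{N_p}(t)}. Then for every z in the upper half-plane ℍ, Δ_N(z/(p^k z + 1)) · (p^k z + 1)^{−12·φ(N)} = p^{−12·φ(N_p)·(p^n (n−k) − p^{n−1}(n−k−1))} · C_{N_p}^{p^n − p^{n−1}} · Π_{t ∣ N_p} [ Δ((p^k z + 1)/(p^{n−k} t))^{p^n} · Δ((p^k z + 1)/(p^{n−k−1} t))^{−p^{n−1}} ]^{a_{N_p}(t)}. -/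
namespace PaperStmt

/-- `a_N(t) = Σ_{r ∣ t} μ(t/r)·μ(N/r)·φ(N)/φ(N/r)` (the divisions are exact for `t ∣ N`). -/
def aN (N t : ℕ) : ℤ :=
  ∑ r ∈ t.divisors, ArithmeticFunction.moebius (t / r) * ArithmeticFunction.moebius (N / r) *
    ((N.totient / (N / r).totient : ℕ) : ℤ)

/-- The modular discriminant `Δ(z) = q·Π_{n≥1}(1 − q^n)^24`, `q = e^{2πiz}`, for `Im z > 0`. -/
noncomputable def Disc (z : ℂ) : ℂ :=
  Complex.exp (2 * (Real.pi : ℂ) * Complex.I * z) *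
    ∏' n : ℕ, (1 - Complex.exp (2 * (Real.pi : ℂ) * Complex.I * z) ^ (n + 1)) ^ 24

/-- `Δ_M(z) = Π_{t ∣ M} Δ(tz)^{a_M(t)}`. -/
noncomputable def DiscN (M : ℕ) (z : ℂ) : ℂ :=
  ∏ t ∈ M.divisors, Disc ((t : ℂ) * z) ^ aN M t

section Coefficients

open ArithmeticFunction Finset

theorem prod_divisors_mul_of_coprime {α : Type*} [CommMonoid α] {a b : ℕ} (hab : a.Coprime b)
    (f : ℕ → α) :
    ∏ d ∈ (a * b).divisors, f d = ∏ x ∈ a.divisors, ∏ y ∈ b.divisors, f (x * y) := by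
  rw [Nat.divisors_mul, Finset.mul_def, prod_image hab.mul_injOn_divisors, prod_product]

theorem sum_divisors_mul_of_coprime {α : Type*} [AddCommMonoid α] {a b : ℕ} (hab : a.Coprime b)
    (f : ℕ → α) :
    ∑ d ∈ (a * b).divisors, f d = ∑ x ∈ a.divisors, ∑ y ∈ b.divisors, f (x * y) :=
  prod_divisors_mul_of_coprime (α := Multiplicative α) hab f

theorem aN_mul_of_coprime {a b s t : ℕ} (hab : a.Coprime b) (hs : s ∣ a) (ht : t ∣ b) :
    aN (a * b) (s * t) = aN a s * aN b t := by
  have hst : s.Coprime t := hab.of_dvd hs ht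
  unfold aN
  rw [sum_divisors_mul_of_coprime hst, sum_mul_sum]
  refine sum_congr rfl fun x hx => sum_congr rfl fun y hy => ?_
  have hx := Nat.dvd_of_mem_divisors hx
  have hy := Nat.dvd_of_mem_divisors hy
  have hxa := hx.trans hs
  have hyb := hy.trans ht
  have h₁ : (s / x).Coprime (t / y) :=
    hst.of_dvd (Nat.div_dvd_of_dvd hx) (Nat.div_dvd_of_dvd hy)
  have h₂ : (a / x).Coprime (b / y) :=
    hab.of_dvd (Nat.div_dvd_of_dvd hxa) (Nat.div_dvd_of_dvd hyb)
  rw [← Nat.div_mul_div_comm hx hy, ← Nat.div_mul_div_comm hxa hyb,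
    isMultiplicative_moebius.map_mul_of_coprime h₁,
    isMultiplicative_moebius.map_mul_of_coprime h₂, Nat.totient_mul hab, Nat.totient_mul h₂,
    ← Nat.div_mul_div_comm (Nat.totient_dvd_of_dvd (Nat.div_dvd_of_dvd hxa))
      (Nat.totient_dvd_of_dvd (Nat.div_dvd_of_dvd hyb))]
  push_cast
  ring

theorem sum_divisors_aN {N : ℕ} (hN : 0 < N) : ∑ t ∈ N.divisors, aN N t = N.totient := by
  have h := (sum_eq_iff_sum_mul_moebius_eq (R := ℤ) (f := aN N)
    (g := fun r => moebius (N / r) * ((N.totient / (N / r).totient : ℕ) : ℤ))).2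
    (fun t _ => by
      simp only [aN, Int.cast_id, mul_assoc]
      exact Nat.sum_divisorsAntidiagonal' (fun x y => moebius x *
        (moebius (N / y) * ((N.totient / (N / y).totient : ℕ) : ℤ)))) N hN
  simpa [Nat.div_self hN] using h

theorem moebius_prime_pow_eq_zero {p : ℕ} (hp : p.Prime) {k : ℕ} (hk : 2 ≤ k) :
    moebius (p ^ k) = 0 := by
  rw [moebius_apply_prime_pow hp (by omega), if_neg (by omega)]

theorem aN_prime_pow_eq_zero {p : ℕ} (hp : p.Prime) {m j : ℕ} (hj : j < m) :
    aN (p ^ (m + 1)) (p ^ j) = 0 := by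
  unfold aN
  rw [Nat.sum_divisors_prime_pow hp]
  refine sum_eq_zero fun i hi => ?_
  have hi : i < j + 1 := mem_range.1 hi
  rw [Nat.pow_div (by omega) hp.pos (m := m + 1), moebius_prime_pow_eq_zero hp (by omega)]
  simp

theorem totient_prime_pow_div {p : ℕ} (hp : p.Prime) (m : ℕ) :
    (p ^ (m + 1)).totient / p.totient = p ^ m := by
  rw [Nat.totient_prime_pow_succ hp, Nat.totient_prime hp]
  exact Nat.mul_div_cancel _ (by have := hp.two_le; omega)

theorem aN_prime_pow_pred {p : ℕ} (hp : p.Prime) (m : ℕ) :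
    aN (p ^ (m + 1)) (p ^ m) = -(p : ℤ) ^ m := by
  unfold aN
  rw [Nat.sum_divisors_prime_pow hp, sum_range_succ, sum_eq_zero]
  · rw [Nat.div_self (pow_pos hp.pos m), Nat.pow_div (by omega) hp.pos]
    simp [moebius_apply_prime hp, totient_prime_pow_div hp]
  · intro i hi
    have hi : i < m := mem_range.1 hi
    rw [Nat.pow_div (by omega) hp.pos (m := m + 1), moebius_prime_pow_eq_zero hp (by omega)]
    simp

theorem aN_prime_pow_self {p : ℕ} (hp : p.Prime) (m : ℕ) :
    aN (p ^ (m + 1)) (p ^ (m + 1)) = (p : ℤ) ^ (m + 1) := by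
  unfold aN
  rw [Nat.sum_divisors_prime_pow hp, sum_range_succ, sum_range_succ, sum_eq_zero]
  · rw [Nat.div_self (pow_pos hp.pos _), Nat.pow_div (by omega) hp.pos, Nat.add_sub_cancel_left,
      pow_one, totient_prime_pow_div hp]
    simp [moebius_apply_prime hp, Nat.totient_prime_pow_succ hp, Nat.cast_sub hp.one_le]
    ring
  · intro i hi
    have hi : i < m := mem_range.1 hi
    rw [Nat.pow_div (by omega) hp.pos (m := m + 1), moebius_prime_pow_eq_zero hp (by omega)]
    simp

theorem DiscN_prime_pow_mul {p : ℕ} (hp : p.Prime) {M : ℕ} (hM : p.Coprime M) (m : ℕ) (z : ℂ) :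
    DiscN (p ^ (m + 1) * M) z = ∏ t ∈ M.divisors,
      (Disc ((p : ℂ) ^ (m + 1) * t * z) ^ ((p : ℤ) ^ (m + 1)) *
        Disc ((p : ℂ) ^ m * t * z) ^ (-(p : ℤ) ^ m)) ^ aN M t := by
  have hcop : (p ^ (m + 1)).Coprime M := hM.pow_left _
  have haN {j t : ℕ} (hj : j ≤ m + 1) (ht : t ∈ M.divisors) :
      aN (p ^ (m + 1) * M) (p ^ j * t) = aN (p ^ (m + 1)) (p ^ j) * aN M t :=
    aN_mul_of_coprime hcop (pow_dvd_pow p hj) (Nat.dvd_of_mem_divisors ht)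
  unfold DiscN
  rw [prod_divisors_mul_of_coprime hcop, Nat.prod_divisors_prime_pow hp, prod_range_succ,
    prod_range_succ, prod_eq_one, one_mul, ← prod_mul_distrib]
  · refine prod_congr rfl fun t ht => ?_
    rw [haN (by omega) ht, haN le_rfl ht, aN_prime_pow_pred hp, aN_prime_pow_self hp, mul_zpow,
      zpow_mul, zpow_mul]
    push_cast
    ring
  · intro j hj
    have hj : j < m := mem_range.1 hj
    refine prod_eq_one fun t ht => ?_
    rw [haN (by omega) ht, aN_prime_pow_eq_zero hp hj, zero_mul, zpow_zero]

end Coefficients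

section Discriminant

open ModularForm

theorem Disc_eq_discriminant (z : UpperHalfPlane) : Disc z = discriminant z := by
  rw [discriminant_eq_q_prod, Disc]
  simp [eta_q_eq_pow, Function.Periodic.qParam]

theorem Disc_add_natCast (z : ℂ) (n : ℕ) : Disc (z + n) = Disc z := by
  have : Complex.exp (2 * (Real.pi : ℂ) * Complex.I * (z + n)) =
      Complex.exp (2 * (Real.pi : ℂ) * Complex.I * z) := by
    rw [mul_add, mul_comm (2 * (Real.pi : ℂ) * Complex.I) (n : ℂ), Complex.exp_add,
      Complex.exp_nat_mul_two_pi_mul_I, mul_one]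
  simp only [Disc, this]

theorem Disc_neg_inv {z : ℂ} (hz : 0 < z.im) : Disc (-z⁻¹) = z ^ 12 * Disc z := by
  let τ : UpperHalfPlane := ⟨z, hz⟩
  have h := congrFun discriminant_S_invariant τ
  rw [SL_slash_apply, UpperHalfPlane.modular_S_smul, ModularGroup.denom_S] at h
  have hτ : (τ : ℂ) ≠ 0 := τ.ne_zero
  have h₁ := Disc_eq_discriminant τ
  have h₂ := Disc_eq_discriminant (UpperHalfPlane.mk _ τ.im_inv_neg_coe_pos)
  rw [← h₁, ← h₂] at h
  have h₃ : Disc (-z)⁻¹ * z ^ (-12 : ℤ) = Disc z := h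
  have hz0 : z ≠ 0 := hτ
  rw [← h₃, ← neg_inv]
  field_simp

theorem natCast_mul_add_one_im_pos {z : ℂ} (hz : 0 < z.im) {a : ℕ} (ha : 0 < a) :
    0 < ((a : ℂ) * z + 1).im := by
  have : (0 : ℝ) < a := by exact_mod_cast ha
  simpa using mul_pos this hz

theorem Disc_natCast_mul_div {z : ℂ} (hz : 0 < z.im) {a b : ℕ} (ha : 0 < a) (hb : 0 < b) :
    Disc ((a : ℂ) * b * (z / (a * z + 1))) =
      (((a : ℂ) * z + 1) / b) ^ (12 : ℤ) * Disc ((a * z + 1) / b) := by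
  have hw := natCast_mul_add_one_im_pos hz ha
  have hw0 : (a : ℂ) * z + 1 ≠ 0 := fun h => by simp [h] at hw
  have hb0 : (b : ℂ) ≠ 0 := by exact_mod_cast hb.ne'
  have him : 0 < (((a : ℂ) * z + 1) / b).im := by
    rw [Complex.div_natCast_im]
    have : (0 : ℝ) < b := by exact_mod_cast hb
    exact div_pos hw this
  have hshift : (a : ℂ) * b * (z / (a * z + 1)) = -(((a : ℂ) * z + 1) / b)⁻¹ + b := by
    field_simp
    ring
  rw [hshift, Disc_add_natCast, Disc_neg_inv him]
  rfl

end Discriminant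

theorem prod_zpow_eq_zpow_sum {ι G : Type*} [CommGroupWithZero G] {x : G} (hx : x ≠ 0)
    (s : Finset ι) (f : ι → ℤ) : ∏ i ∈ s, x ^ f i = x ^ ∑ i ∈ s, f i := by
  classical
  induction s using Finset.induction_on with
  | empty => simp
  | insert i s hi ih => rw [Finset.prod_insert hi, Finset.sum_insert hi, zpow_add₀ hx, ih]

/-- for `p ∣ N`, `n = v_p(N)`, `N_p = N·p^{−n}`, `0 ≤ k < n`,
`C_{N_p} = Π_{t ∣ N_p} t^{−12 a_{N_p}(t)}`, and `z` in the upper half-plane,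
`Δ_N(z/(p^k z+1)) · (p^k z+1)^{−12 φ(N)}
  = p^{−12 φ(N_p)(p^n (n−k) − p^{n−1}(n−k−1))} · C_{N_p}^{p^n − p^{n−1}}
    · Π_{t ∣ N_p} [Δ((p^k z+1)/(p^{n−k} t))^{p^n} · Δ((p^k z+1)/(p^{n−k−1} t))^{−p^{n−1}}]^{a_{N_p}(t)}`. -/
theorem statement12 (N p : ℕ) (hN : 0 < N) (hp : p.Prime) (hpN : p ∣ N)
    (n : ℕ) (hn : n = padicValNat p N) (Np : ℕ) (hNp : Np = N / p ^ n)
    (k : ℕ) (hk : k < n) (z : ℂ) (hz : 0 < z.im) :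
    DiscN N (z / ((p : ℂ) ^ k * z + 1)) *
        ((p : ℂ) ^ k * z + 1) ^ (-(12 * (N.totient : ℤ))) =
      (p : ℂ) ^ (-(12 * (Np.totient : ℤ)) *
          ((p : ℤ) ^ n * ((n : ℤ) - k) - (p : ℤ) ^ (n - 1) * ((n : ℤ) - k - 1))) *
      (∏ t ∈ Np.divisors, (t : ℂ) ^ (-(12 * aN Np t))) ^ ((p : ℤ) ^ n - (p : ℤ) ^ (n - 1)) *
      ∏ t ∈ Np.divisors,
        (Disc (((p : ℂ) ^ k * z + 1) / ((p : ℂ) ^ (n - k) * (t : ℂ))) ^ ((p : ℤ) ^ n) *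
          Disc (((p : ℂ) ^ k * z + 1) / ((p : ℂ) ^ (n - k - 1) * (t : ℂ))) ^
            (-(p : ℤ) ^ (n - 1))) ^ aN Np t := by
  obtain ⟨m, rfl⟩ : ∃ m, n = m + 1 := ⟨n - 1, by omega⟩
  have hpow : p ^ (m + 1) ∣ N := hn ▸ pow_padicValNat_dvd
  have hNeq : N = p ^ (m + 1) * Np := by rw [hNp, Nat.mul_div_cancel' hpow]
  have hcop : p.Coprime Np := by
    rw [hp.coprime_iff_not_dvd]
    intro hdvd
    have : p ^ (m + 1 + 1) ∣ N := by
      rw [hNeq, pow_succ p (m + 1)]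
      exact mul_dvd_mul_left _ hdvd
    have := (padicValNat_dvd_iff_le (hp := ⟨hp⟩) hN.ne').1 this
    omega
  have hNp0 : 0 < Np := Nat.pos_of_ne_zero fun h => by simp [h] at hNeq; omega
  have htot : (N.totient : ℤ) = ((p : ℤ) ^ (m + 1) - (p : ℤ) ^ m) * Np.totient := by
    rw [hNeq, Nat.totient_mul (hcop.pow_left _), Nat.totient_prime_pow_succ hp]
    push_cast [Nat.cast_sub hp.one_le]
    ring
  have hp0 : (p : ℂ) ≠ 0 := by exact_mod_cast hp.ne_zero
  set w : ℂ := (p : ℂ) ^ k * z + 1 with hw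
  have hw0 : w ≠ 0 := fun h => by
    have him := natCast_mul_add_one_im_pos hz (pow_pos hp.pos k)
    rw [Nat.cast_pow, ← hw, h] at him
    exact him.ne rfl
  have hDisc {j t : ℕ} (hj : k ≤ j) (ht : 0 < t) : Disc ((p : ℂ) ^ j * t * (z / w)) =
      (w / ((p : ℂ) ^ (j - k) * t)) ^ (12 : ℤ) * Disc (w / ((p : ℂ) ^ (j - k) * t)) := by
    have h := Disc_natCast_mul_div hz (pow_pos hp.pos k)
      (Nat.mul_pos (pow_pos hp.pos (j - k)) ht)
    push_cast at h
    rw [← hw, ← mul_assoc, ← pow_add, Nat.add_sub_cancel' hj] at h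
    exact h
  have hfactor {t : ℕ} (ht : t ∈ Np.divisors) :
      (Disc ((p : ℂ) ^ (m + 1) * t * (z / w)) ^ ((p : ℤ) ^ (m + 1)) *
        Disc ((p : ℂ) ^ m * t * (z / w)) ^ (-(p : ℤ) ^ m)) ^ aN Np t =
      (w ^ (12 * ((p : ℤ) ^ (m + 1) - (p : ℤ) ^ m)) *
        (p : ℂ) ^ (-12 * ((p : ℤ) ^ (m + 1) * ((m + 1 : ℤ) - k) -
          (p : ℤ) ^ m * ((m : ℤ) - k)))) ^ aN Np t *
      ((t : ℂ) ^ (-(12 * aN Np t))) ^ ((p : ℤ) ^ (m + 1) - (p : ℤ) ^ m) *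
      (Disc (w / ((p : ℂ) ^ (m + 1 - k) * t)) ^ ((p : ℤ) ^ (m + 1)) *
        Disc (w / ((p : ℂ) ^ (m - k) * t)) ^ (-(p : ℤ) ^ m)) ^ aN Np t := by
    have htpos : 0 < t := Nat.pos_of_mem_divisors ht
    have ht0 : (t : ℂ) ≠ 0 := by exact_mod_cast htpos.ne'
    have h₁ : ((m + 1 - k : ℕ) : ℤ) = (m + 1 : ℤ) - k := by omega
    have h₂ : ((m - k : ℕ) : ℤ) = (m : ℤ) - k := by omega
    rw [hDisc (by omega) htpos, hDisc (by omega) htpos]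
    generalize Disc (w / ((p : ℂ) ^ (m + 1 - k) * t)) = D₁
    generalize Disc (w / ((p : ℂ) ^ (m - k) * t)) = D₀
    rw [← zpow_natCast (p : ℂ) (m + 1 - k), ← zpow_natCast (p : ℂ) (m - k), h₁, h₂]
    generalize (p : ℤ) ^ (m + 1) = A
    generalize (p : ℤ) ^ m = B
    generalize aN Np t = a
    generalize ((m + 1 : ℤ) - k) = u
    generalize ((m : ℤ) - k) = v
    have hscalar : ((w / ((p : ℂ) ^ u * t)) ^ (12 : ℤ)) ^ A *
        ((w / ((p : ℂ) ^ v * t)) ^ (12 : ℤ)) ^ (-B) =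
        w ^ (12 * (A - B)) * (p : ℂ) ^ (-12 * (A * u - B * v)) * (t : ℂ) ^ (-12 * (A - B)) := by
      simp only [mul_zpow, ← zpow_mul, div_eq_mul_inv, mul_inv, inv_zpow', ← zpow_neg]
      rw [show 12 * (A - B) = 12 * A + 12 * -B by ring,
        show -12 * (A * u - B * v) = -(u * 12 * A) + -(v * 12 * -B) by ring,
        show -12 * (A - B) = -(12 * A) + -(12 * -B) by ring,
        zpow_add₀ hw0, zpow_add₀ hp0, zpow_add₀ ht0]
      ring_nf
    rw [← zpow_mul (t : ℂ), show -(12 * a) * (A - B) = -12 * (A - B) * a by ring,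
      zpow_mul (t : ℂ), ← mul_zpow, ← mul_zpow, ← hscalar, mul_zpow _ D₁, mul_zpow _ D₀]
    congr 1
    ring
  rw [hNeq, DiscN_prime_pow_mul hp hcop, ← hNeq, Finset.prod_congr rfl fun t ht => hfactor ht,
    Finset.prod_mul_distrib, Finset.prod_mul_distrib, Finset.prod_zpow,
    prod_zpow_eq_zpow_sum (mul_ne_zero (zpow_ne_zero _ hw0) (zpow_ne_zero _ hp0)),
    sum_divisors_aN hNp0, htot, mul_zpow, ← zpow_mul, ← zpow_mul, Nat.add_sub_cancel,
    show m + 1 - k - 1 = m - k by omega]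
  push_cast
  rw [show -12 * ((p : ℤ) ^ (m + 1) * ((m + 1 : ℤ) - k) - (p : ℤ) ^ m * ((m : ℤ) - k)) *
      (Np.totient : ℤ) = -(12 * (Np.totient : ℤ)) *
        ((p : ℤ) ^ (m + 1) * ((m : ℤ) + 1 - k) - (p : ℤ) ^ m * ((m : ℤ) + 1 - k - 1)) by ring,
    show -(12 * (((p : ℤ) ^ (m + 1) - (p : ℤ) ^ m) * (Np.totient : ℤ))) =
      -(12 * ((p : ℤ) ^ (m + 1) - (p : ℤ) ^ m) * Np.totient) by ring]
  have hcancel := zpow_ne_zero (12 * ((p : ℤ) ^ (m + 1) - (p : ℤ) ^ m) * Np.totient) hw0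
  rw [zpow_neg w, mul_inv_eq_iff_eq_mul₀ hcancel]
  ring

end PaperStmt
end

section
/- Let p be a prime and n, k integers with 0 ≤ k ≤ n. Let A, b, d be integers with A·b − d·p^k = 1, and let γ = [[A, d], [p^k, b]] ∈ SL₂(ℤ). Then for every integer x, γ · [[1, x], [0, 1]] · γ^{−1} = [[1 − p^k A x, A² x], [−p^{2k} x, 1 + p^k A x]], and this matrix lies in Γ₀(p^n) if and only if p^{max(n−2k, 0)} divides x. Consequently, γ · {[[1, x], [0, 1]] : x ∈ ℤ} · γ^{−1} ∩ Γ₀(p^n) = {[[1 − p^k A x, A² x], [−p^{2k} x, 1 + p^k A x]] : x ∈ p^{max(n−2k,0)}ℤ}. -/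
open scoped MatrixGroups

namespace PaperStmt

/-- The matrix `γ = [[A, d], [p^k, b]]`, an element of `SL₂(ℤ)` when `A·b − d·p^k = 1`. -/
def gam (p k : ℕ) (A b d : ℤ) (h : A * b - d * (p : ℤ) ^ k = 1) : SL(2, ℤ) :=
  ⟨!![A, d; (p : ℤ) ^ k, b], by rw [Matrix.det_fin_two_of]; linarith⟩

/-- The unipotent matrix `[[1, x], [0, 1]]` as an element of `SL₂(ℤ)`. -/
def uMat (x : ℤ) : SL(2, ℤ) :=
  ⟨!![1, x; 0, 1], by rw [Matrix.det_fin_two_of]; ring⟩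

/-- The matrix `[[1 − p^k A x, A² x], [−p^{2k} x, 1 + p^k A x]]` as an element of `SL₂(ℤ)`. -/
def vMat (p k : ℕ) (A x : ℤ) : SL(2, ℤ) :=
  ⟨!![1 - (p : ℤ) ^ k * A * x, A ^ 2 * x; -(p : ℤ) ^ (2 * k) * x, 1 + (p : ℤ) ^ k * A * x], by
    rw [Matrix.det_fin_two_of]; ring⟩

theorem conj_uMat (p k : ℕ) (A b d : ℤ) (h : A * b - d * (p : ℤ) ^ k = 1) (x : ℤ) :
    gam p k A b d h * uMat x * (gam p k A b d h)⁻¹ = vMat p k A x := by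
  rw [mul_inv_eq_iff_eq_mul]
  apply Subtype.ext
  rw [Matrix.SpecialLinearGroup.coe_mul, Matrix.SpecialLinearGroup.coe_mul]
  ext i j
  fin_cases i <;> fin_cases j <;>
    simp [gam, uMat, vMat, Matrix.mul_apply, Fin.sum_univ_two]
  · ring
  · linear_combination (-A * x) * h
  · ring
  · linear_combination (-(p : ℤ) ^ k * x) * h

theorem vMat_mem_Gamma0_iff {p : ℕ} (hp : p ≠ 0) (n k : ℕ) (A x : ℤ) :
    vMat p k A x ∈ CongruenceSubgroup.Gamma0 (p ^ n) ↔ (p : ℤ) ^ (n - 2 * k) ∣ x := by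
  have hentry : (vMat p k A x) 1 0 = -((p : ℤ) ^ (2 * k) * x) := by simp [vMat]
  rw [CongruenceSubgroup.Gamma0_mem, hentry, ZMod.intCast_zmod_eq_zero_iff_dvd, dvd_neg,
    Nat.cast_pow]
  rcases le_total n (2 * k) with hnk | hnk
  · simpa [Nat.sub_eq_zero_of_le hnk] using (pow_dvd_pow (p : ℤ) hnk).mul_right x
  · conv_lhs => rw [← Nat.add_sub_cancel' hnk, pow_add]
    exact mul_dvd_mul_iff_left (pow_ne_zero _ (Nat.cast_ne_zero.mpr hp))

/-- with `γ = [[A, d], [p^k, b]] ∈ SL₂(ℤ)` (so `A·b − d·p^k = 1`), for every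
integer `x` one has `γ·[[1,x],[0,1]]·γ⁻¹ = [[1 − p^k A x, A² x], [−p^{2k} x, 1 + p^k A x]]`,
this matrix lies in `Γ₀(p^n)` iff `p^{max(n−2k,0)} ∣ x` (here `n - 2*k` is truncated
subtraction), and consequently
`γ·{[[1,x],[0,1]] : x ∈ ℤ}·γ⁻¹ ∩ Γ₀(p^n) = {[[1 − p^k A x, A² x], [−p^{2k} x, 1 + p^k A x]] :
x ∈ p^{max(n−2k,0)}ℤ}`. -/
theorem statement13 (p : ℕ) (hp : p.Prime) (n k : ℕ) (hk : k ≤ n)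
    (A b d : ℤ) (h : A * b - d * (p : ℤ) ^ k = 1) :
    (∀ x : ℤ, gam p k A b d h * uMat x * (gam p k A b d h)⁻¹ = vMat p k A x) ∧
    (∀ x : ℤ, vMat p k A x ∈ CongruenceSubgroup.Gamma0 (p ^ n) ↔ (p : ℤ) ^ (n - 2 * k) ∣ x) ∧
    ({g : SL(2, ℤ) | ∃ x : ℤ, g = gam p k A b d h * uMat x * (gam p k A b d h)⁻¹} ∩
        (CongruenceSubgroup.Gamma0 (p ^ n) : Set SL(2, ℤ)) =
      {g : SL(2, ℤ) | ∃ x : ℤ, (p : ℤ) ^ (n - 2 * k) ∣ x ∧ g = vMat p k A x}) := by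
  have hconj := conj_uMat p k A b d h
  have hmem := fun x => vMat_mem_Gamma0_iff hp.ne_zero n k A x
  refine ⟨hconj, hmem, ?_⟩
  ext g
  simp only [hconj, Set.mem_inter_iff, Set.mem_ofPred_eq, SetLike.mem_coe]
  constructor
  · rintro ⟨⟨x, rfl⟩, hx⟩
    exact ⟨x, (hmem x).mp hx, rfl⟩
  · rintro ⟨x, hx, rfl⟩
    exact ⟨⟨x, rfl⟩, (hmem x).mpr hx⟩

end PaperStmt
end
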